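/- Under the assumptions of the preceding setting, suppose in addition that 𝒮* = {q*} consists of a single point and that for every ε > 0 there exists δ > 0 such that 𝒮*_δ ⊆ B(q*, ε), where B(q*, ε) is the open ball of radius ε around q* in the Prokhorov metric. Then μ_n converges weakly to the Dirac measure δ_{q*}. -/

import Mathlib

open MeasureTheory Filter Topology

theorem aux_nhds {Y : Type*} {𝒢 : Set (Set Y)} (h : 𝒢.Countable) (P : Y) :
    (@nhds Y (TopologicalSpace.generateFrom 𝒢) P).IsCountablyGenerated ∧
      ∀ s ∈ 𝒢, P ∈ s → s ∈ @nhds Y (TopologicalSpace.generateFrom 𝒢) P := by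
  letI t' : TopologicalSpace Y := TopologicalSpace.generateFrom 𝒢
  have hsc : SecondCountableTopology Y := ⟨𝒢, h, rfl⟩
  exact ⟨inferInstance, fun s hs hP =>
    (TopologicalSpace.isOpen_generateFrom_of_mem hs).mem_nhds hP⟩

theorem aux_secondCountable (X : Type*) [MeasurableSpace X] [TopologicalSpace X] [PolishSpace X]
    [BorelSpace X] : SecondCountableTopology (ProbabilityMeasure X) := by
  classical
  set B := TopologicalSpace.countableBasis X with hB
  have hBc : B.Countable := TopologicalSpace.countable_countableBasis X
  have hBb : TopologicalSpace.IsTopologicalBasis B := TopologicalSpace.isBasis_countableBasis X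
  let I : Set (Set (Set X)) := {s | s.Finite ∧ s ⊆ B}
  have hI : I.Countable := Set.countable_ofPred_finite_subset hBc
  let g : Set (Set X) × ℚ → Set (ProbabilityMeasure X) :=
    fun p => {P | ENNReal.ofReal (p.2 : ℝ) < (P : Measure X) (⋃₀ p.1)}
  let 𝒢 : Set (Set (ProbabilityMeasure X)) := g '' (I ×ˢ Set.univ)
  have h𝒢 : 𝒢.Countable := (hI.prod Set.countable_univ).image g
  refine ⟨𝒢, h𝒢, le_antisymm ?_ ?_⟩
  · refine le_generateFrom ?_
    rintro _ ⟨⟨s, r⟩, ⟨hs, -⟩, rfl⟩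
    rw [isOpen_iff_mem_nhds]
    intro P hP
    have hopen : IsOpen (⋃₀ s) := isOpen_sUnion fun t ht => hBb.isOpen (hs.2 ht)
    have h := ProbabilityMeasure.le_liminf_measure_open_of_tendsto
      (tendsto_id (x := 𝓝 P)) hopen
    exact eventually_lt_of_lt_liminf (lt_of_lt_of_le hP h)
  · rw [le_iff_nhds]
    intro P
    obtain ⟨hL, hLmem⟩ := aux_nhds h𝒢 P
    generalize @nhds _ (TopologicalSpace.generateFrom 𝒢) P = L at hL hLmem ⊢
    have key : Tendsto (fun Q : ProbabilityMeasure X => Q) L (𝓝 P) := by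
      apply tendsto_of_forall_isOpen_le_liminf'
      intro G hG
      refine le_of_forall_lt fun a ha => ?_
      obtain ⟨b, hab, hb⟩ := exists_between ha
      obtain ⟨T, hTB, hGT⟩ := hBb.open_eq_sUnion hG
      have hTc : T.Countable := hBc.mono hTB
      have hun : G = ⋃ s ∈ {s : Set (Set X) | s.Finite ∧ s ⊆ T}, ⋃₀ s := by
        rw [hGT]
        ext x
        simp only [Set.mem_sUnion, Set.mem_iUnion, Set.mem_ofPred_eq]
        constructor
        · rintro ⟨t, ht, hx⟩
          exact ⟨{t}, ⟨Set.finite_singleton t, by simpa using ht⟩, t, rfl, hx⟩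
        · rintro ⟨s, ⟨-, hs⟩, t, ht, hx⟩
          exact ⟨t, hs ht, hx⟩
      have hdir : DirectedOn (Function.onFun (· ⊆ ·) fun s : Set (Set X) => ⋃₀ s)
          {s : Set (Set X) | s.Finite ∧ s ⊆ T} := by
        intro s hs u hu
        exact ⟨s ∪ u, ⟨hs.1.union hu.1, Set.union_subset hs.2 hu.2⟩,
          Set.sUnion_subset_sUnion Set.subset_union_left,
          Set.sUnion_subset_sUnion Set.subset_union_right⟩
      have hsup : (P : Measure X) G
          = ⨆ s ∈ {s : Set (Set X) | s.Finite ∧ s ⊆ T}, (P : Measure X) (⋃₀ s) := by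
        conv_lhs => rw [hun]
        exact measure_biUnion_eq_iSup (Set.countable_ofPred_finite_subset hTc) hdir
      rw [hsup] at hb
      simp only [lt_iSup_iff] at hb
      obtain ⟨s, hs, hbs⟩ := hb
      obtain ⟨r, -, hbr, hrs⟩ := ENNReal.lt_iff_exists_rat_btwn.1 hbs
      refine lt_of_lt_of_le hab ?_
      have hmem : g (s, r) ∈ L := by
        refine hLmem _ ⟨(s, r), ⟨⟨hs.1, hs.2.trans hTB⟩, Set.mem_univ _⟩, rfl⟩ ?_
        exact hrs
      refine le_liminf_of_le (by isBoundedDefault) ?_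
      filter_upwards [hmem] with Q hQ
      refine (hbr.trans hQ).le.trans (measure_mono ?_)
      rw [hGT]
      exact Set.sUnion_subset_sUnion hs.2
    exact key

/-- **Corollary `point`.**
In the setting of Proposition `point2`, if moreover `𝒮* = {q*}` and for every
neighborhood of `q*` (equivalently, every Prokhorov ball `B(q*, ε)`) there is `δ > 0`
with `𝒮*_δ` contained in it, then `μₙ ⇒ δ_{q*}`. -/
theorem stmt_9
    {X : Type*} [MeasurableSpace X] [TopologicalSpace X] [PolishSpace X] [BorelSpace X]
    [MeasurableSpace (ProbabilityMeasure X)] [BorelSpace (ProbabilityMeasure X)]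
    (π : Measure (ProbabilityMeasure X)) [IsFiniteMeasure π]
    (fn : ℕ → ProbabilityMeasure X → ℝ) (f : ProbabilityMeasure X → ℝ)
    (hfnmeas : ∀ n, Measurable (fn n)) (hfmeas : Measurable f)
    (hfn0 : ∀ n q, 0 ≤ fn n q) (hf0 : ∀ q, 0 ≤ f q)
    (hfnbdd : ∀ n, ∃ C : ℝ, ∀ᵐ q ∂π, fn n q ≤ C)
    (hunif : Tendsto (fun n => essSup (fun q => |fn n q - f q|) π) atTop (𝓝 0))
    (hfsup_pos : 0 < essSup f π)
    (m : ℕ → ℝ) (hmpos : ∀ n, 0 < m n) (hmmono : StrictMono m)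
    (hmtop : Tendsto m atTop atTop)
    (hIntpos : ∀ n, 0 < ∫ q, fn n q ^ m n ∂π)
    (hInt : ∀ n, Integrable (fun q => fn n q ^ m n) π)
    (S : Set (ProbabilityMeasure X))
    (hS : S = {p : ProbabilityMeasure X | ∀ U : Set (ProbabilityMeasure X),
      IsOpen U → p ∈ U → 0 < π U})
    (Sstar : Set (ProbabilityMeasure X))
    (hSstar : Sstar = {q ∈ S | f q = essSup f π})
    (Sdelta : ℝ → Set (ProbabilityMeasure X))
    (hSdelta : ∀ δ : ℝ, Sdelta δ = {q ∈ S | essSup f π - δ < f q})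
    (μn : ℕ → ProbabilityMeasure (ProbabilityMeasure X))
    (hμn : ∀ (n : ℕ) (E : Set (ProbabilityMeasure X)), MeasurableSet E →
      ((μn n : Measure (ProbabilityMeasure X)) E).toReal
        = (∫ q in E, fn n q ^ m n ∂π) / ∫ q, fn n q ^ m n ∂π)
    (qstar : ProbabilityMeasure X)
    (hqstar : Sstar = {qstar})
    (hballs : ∀ U ∈ 𝓝 qstar, ∃ δ : ℝ, 0 < δ ∧ Sdelta δ ⊆ U) :
    Tendsto μn atTop
      (𝓝 (⟨Measure.dirac qstar, inferInstance⟩ : ProbabilityMeasure (ProbabilityMeasure X))) := by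
  have := aux_secondCountable X
  have hSae : ∀ᵐ q ∂π, q ∈ S := by
    have h : π.support ∈ ae π := Measure.support_mem_ae
    filter_upwards [h] with q hq
    rw [hS]
    intro U hU hqU
    exact (Measure.mem_support_iff_forall q).1 hq U (hU.mem_nhds hqU)
  set M := essSup f π with hM
  have hfb : IsBoundedUnder (· ≤ ·) (ae π) f := by
    by_contra hcon
    have : M = 0 := by
      rw [hM, essSup_eq_sInf]
      suffices hemp : {a | π {x | a < f x} = 0} = ∅ by rw [hemp, Real.sInf_empty]
      rw [Set.eq_empty_iff_forall_notMem]
      intro a ha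
      apply hcon
      refine ⟨a, ?_⟩
      rw [eventually_map, ae_iff]
      simpa using ha
    linarith
  have hfle : ∀ᵐ q ∂π, f q ≤ M := ae_le_essSup hfb
  have hpos : ∀ c, c < M → π {q | c < f q} ≠ 0 := by
    intro c hc h0
    have hbelow : BddBelow {a | π {x | a < f x} = 0} := by
      refine ⟨0, fun a ha => ?_⟩
      by_contra hlt
      push Not at hlt
      have huniv : {x | a < f x} = Set.univ :=
        Set.eq_univ_of_forall fun x => lt_of_lt_of_le hlt (hf0 x)
      have hz : π = 0 := by
        rw [Set.mem_ofPred_eq, huniv] at ha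
        exact Measure.measure_univ_eq_zero.1 ha
      have := hIntpos 0
      rw [hz] at this
      simp at this
    have : M ≤ c := by
      rw [hM, essSup_eq_sInf]
      exact csInf_le hbelow h0
    linarith
  have hdiff : ∀ ε : ℝ, 0 < ε → ∀ᶠ n in atTop, ∀ᵐ q ∂π, |fn n q - f q| < ε := by
    intro ε hε
    filter_upwards [hunif.eventually_lt_const hε] with n hn
    refine ae_lt_of_essSup_lt hn ?_
    obtain ⟨C, hC⟩ := hfnbdd n
    refine ⟨C + M, ?_⟩
    rw [eventually_map]
    filter_upwards [hC, hfle] with q h1 h2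
    have := hfn0 n q
    have := hf0 q
    rw [abs_le]
    constructor <;> linarith
  have hclosed : ∀ G : Set (ProbabilityMeasure X), IsOpen G → qstar ∈ G →
      Tendsto (fun n => ((μn n : Measure (ProbabilityMeasure X)) Gᶜ).toReal) atTop (𝓝 0) := by
    intro G hG hqG
    obtain ⟨δ₀, hδ₀, hsub₀⟩ := hballs G (hG.mem_nhds hqG)
    obtain ⟨δ, hδ, hδM, hsub⟩ : ∃ δ : ℝ, 0 < δ ∧ δ ≤ M ∧ Sdelta δ ⊆ G := by
      refine ⟨min δ₀ M, lt_min hδ₀ hfsup_pos, min_le_right _ _, ?_⟩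
      refine Set.Subset.trans ?_ hsub₀
      rw [hSdelta, hSdelta]
      rintro q ⟨h1, h2⟩
      exact ⟨h1, by have := min_le_left δ₀ M; linarith⟩
    have hGc : ∀ᵐ q ∂π, q ∈ Gᶜ → f q ≤ M - δ := by
      filter_upwards [hSae] with q hq hqc
      by_contra hcon
      push Not at hcon
      exact hqc (hsub (by rw [hSdelta]; exact ⟨hq, hcon⟩))
    set a := M - 3 * δ / 4 with ha
    set b := M - δ / 2 with hb
    have ha0 : 0 < a := by rw [ha]; linarith
    have hb0 : 0 < b := by rw [hb]; linarith
    have hab : a < b := by rw [ha, hb]; linarith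
    set A := {q | M - δ / 4 < f q} with hA
    have hAm : MeasurableSet A := measurableSet_lt measurable_const hfmeas
    have hA0 : 0 < π.real A := by
      refine ENNReal.toReal_pos (hpos _ (by linarith)) (measure_ne_top _ _)
    have hlim : Tendsto (fun n => π.real Set.univ / π.real A * (a / b) ^ m n) atTop (𝓝 0) := by
      have h := (tendsto_rpow_atTop_of_base_lt_one (a / b)
        (by have : 0 < a / b := by positivity
            linarith) ((div_lt_one hb0).2 hab)).comp hmtop
      simpa using h.const_mul (π.real Set.univ / π.real A)
    refine squeeze_zero' (Eventually.of_forall fun n => ENNReal.toReal_nonneg) ?_ hlim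
    filter_upwards [hdiff (δ / 4) (by linarith)] with n hn
    rw [hμn n _ hG.measurableSet.compl]
    have hm := (hmpos n).le
    have hup : ∫ q in Gᶜ, fn n q ^ m n ∂π ≤ π.real Set.univ * a ^ m n := by
      calc ∫ q in Gᶜ, fn n q ^ m n ∂π ≤ ∫ q in Gᶜ, a ^ m n ∂π := by
            refine setIntegral_mono_on_ae (hInt n).integrableOn
              (integrable_const _) hG.measurableSet.compl ?_
            filter_upwards [hn, hGc] with q h1 h2 hq
            refine Real.rpow_le_rpow (hfn0 n q) ?_ hm
            have := h2 hq
            have := (abs_lt.1 h1).2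
            rw [ha]; linarith
        _ = π.real Gᶜ * a ^ m n := by simp
        _ ≤ _ := by
            gcongr
            · exact measure_ne_top _ _
            · exact Set.subset_univ _
    have hlow : π.real A * b ^ m n ≤ ∫ q, fn n q ^ m n ∂π := by
      calc π.real A * b ^ m n = ∫ q in A, b ^ m n ∂π := by simp
        _ ≤ ∫ q in A, fn n q ^ m n ∂π := by
            refine setIntegral_mono_on_ae (integrable_const _) (hInt n).integrableOn hAm ?_
            filter_upwards [hn] with q h1 hq
            refine Real.rpow_le_rpow hb0.le ?_ hm
            have h3 : M - δ / 4 < f q := hq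
            have := (abs_lt.1 h1).1
            rw [hb]; linarith
        _ ≤ _ := setIntegral_le_integral (hInt n)
            (Eventually.of_forall fun q => Real.rpow_nonneg (hfn0 n q) _)
    have hbm : 0 < b ^ m n := Real.rpow_pos_of_pos hb0 _
    have ham : 0 < a ^ m n := Real.rpow_pos_of_pos ha0 _
    calc _ ≤ (π.real Set.univ * a ^ m n) / (π.real A * b ^ m n) := by
          refine div_le_div₀ (by positivity) hup (by positivity) hlow
      _ = _ := by
          rw [Real.div_rpow ha0.le hb0.le, mul_div_mul_comm]
  apply tendsto_of_forall_isOpen_le_liminf'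
  intro G hG
  by_cases hq : qstar ∈ G
  · have h1 := hclosed G hG hq
    have h2 : Tendsto (fun n => (μn n : Measure (ProbabilityMeasure X)) Gᶜ) atTop (𝓝 0) := by
      rw [← ENNReal.tendsto_toReal_iff (fun n => measure_ne_top _ _) ENNReal.zero_ne_top]
      simpa using h1
    have h3 : Tendsto (fun n => (μn n : Measure (ProbabilityMeasure X)) G) atTop (𝓝 1) := by
      have h4 := ENNReal.Tendsto.sub (tendsto_const_nhds (x := (1 : ENNReal))) h2
        (Or.inl ENNReal.one_ne_top)
      simp only [tsub_zero] at h4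
      refine h4.congr fun n => ?_
      rw [← prob_compl_eq_one_sub hG.measurableSet.compl, compl_compl]
    rw [h3.liminf_eq]
    change (Measure.dirac qstar : Measure (ProbabilityMeasure X)) G ≤ 1
    exact prob_le_one
  · have : (Measure.dirac qstar : Measure (ProbabilityMeasure X)) G = 0 := by
      rw [Measure.dirac_apply' _ hG.measurableSet]
      simp [hq]
    change (Measure.dirac qstar : Measure (ProbabilityMeasure X)) G ≤ _
    rw [this]
    exact zero_le
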